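/- arXiv:2004.08905 — 2 statements merged into one kernel-verified Lean document; each statement's English description precedes it below -/
import Mathlib

section
/- (Non-degeneracy I, item 1.) The curve of tangential frequencies Ω⃗ : [κ₁, κ₂] → ℝ^ν, Ω⃗(κ) = (Ω_{j̄₁}(κ), …, Ω_{j̄_ν}(κ)), is non-degenerate: for every c ∈ ℝ^ν \ {0} there exists κ ∈ [κ₁, κ₂] such that Σ_{a=1}^{ν} c_a · Ω_{j̄_a}(κ) ≠ 0. -/
open Real Finset Set

/-- `G_j := j · tanh(dpt · j)` (finite depth `dpt`). -/
noncomputable def Gfun (dpt : ℝ) (j : ℤ) : ℝ := (j : ℝ) * Real.tanh (dpt * (j : ℝ))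

/-- The linear frequencies `ω_j(κ)`. -/
noncomputable def omegaF (dpt g γ : ℝ) (j : ℤ) (κ : ℝ) : ℝ :=
  Real.sqrt (κ * Gfun dpt j * (j : ℝ) ^ 2 + g * Gfun dpt j + (γ * Gfun dpt j / (2 * (j : ℝ))) ^ 2)

/-- The linear frequencies `Ω_j(κ) = ω_j(κ) + (γ/2) G_j / j`. -/
noncomputable def OmegaF (dpt g γ : ℝ) (j : ℤ) (κ : ℝ) : ℝ :=
  omegaF dpt g γ j κ + γ / 2 * Gfun dpt j / (j : ℝ)

/-- A linear combination of shifted square roots `√(x + r i)` with distinct shifts and of a constant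
vanishes on a nontrivial interval only if all the square roots have coefficient zero. -/
theorem eq_zero_of_sum_mul_sqrt_add_eq_zero {ι : Type*} [Fintype ι] {r C : ι → ℝ} {D a b : ℝ}
    (hr : Function.Injective r) (hra : ∀ i, 0 < a + r i) (hab : a < b)
    (h : ∀ x ∈ Set.Icc a b, ∑ i, C i * √(x + r i) + D = 0) (i : ι) : C i = 0 := by
  classical
  by_contra hi
  obtain ⟨m, hm, hmin⟩ :=
    Finset.exists_min_image (Finset.univ.filter fun i => C i ≠ 0) r ⟨i, by simpa⟩
  have hCm : C m ≠ 0 := by simpa using hm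
  have hlt : ∀ i, C i = 0 ∨ i = m ∨ r m < r i := by
    intro i
    by_cases hC : C i = 0
    · exact Or.inl hC
    · rcases eq_or_ne i m with rfl | him
      · exact Or.inr (Or.inl rfl)
      · exact Or.inr (Or.inr (lt_of_le_of_ne (hmin i (by simpa)) fun e => him (hr e).symm))
  have hpos : EqOn (fun x => ∑ i, C i * √(x + r i) + D) 0 (Set.Ioi (-r m)) := by
    have hmid : (a + b) / 2 ∈ Set.Ioo a b := ⟨by linarith, by linarith⟩
    refine AnalyticOnNhd.eqOn_zero_of_preconnected_of_eventuallyEq_zero (𝕜 := ℝ)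
      (z₀ := (a + b) / 2) (fun x hx => ?_) isPreconnected_Ioi ?_ ?_
    · have hx : -r m < x := hx
      refine ContDiffAt.analyticAt (ContDiffAt.add (ContDiffAt.sum fun i _ => ?_) contDiffAt_const)
      rcases hlt i with hC | hi
      · simpa [hC] using contDiffAt_const
      · have : x + r i ≠ 0 := by
          rcases hi with rfl | hi <;> linarith
        exact contDiffAt_const.mul ((contDiffAt_id.add contDiffAt_const).sqrt this)
    · have := hra m
      simp only [Set.mem_Ioi]
      linarith
    · filter_upwards [Ioo_mem_nhds hmid.1 hmid.2] with x hx
      exact h x (Ioo_subset_Icc_self hx)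
  have hcl : EqOn (fun x => ∑ i, C i * √(x + r i) + D) 0 (Set.Ici (-r m)) := by
    rw [← closure_Ioi]
    exact hpos.closure (by fun_prop) continuous_const
  have hdiff : DifferentiableAt ℝ
      (fun x => -(∑ i ∈ Finset.univ.erase m, C i * √(x + r i) + D) / C m) (-r m) := by
    refine ((DifferentiableAt.fun_sum fun i hi => ?_).add_const D).neg.div_const _
    rcases hlt i with hC | rfl | hi'
    · simp [hC]
    · simp at hi
    · exact ((differentiableAt_id.add_const (r i)).sqrt
        (by simp only [id]; linarith)).const_mul _
  have hsqrt : ∀ x ∈ Set.Ici (-r m),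
      √(x + r m) = -(∑ i ∈ Finset.univ.erase m, C i * √(x + r i) + D) / C m := by
    intro x hx
    have := hcl hx
    simp only [Pi.zero_apply, ← Finset.add_sum_erase _ _ (Finset.mem_univ m)] at this
    rw [eq_div_iff hCm]
    linarith
  have hmem : -r m ∈ Set.Ici (-r m) := Set.mem_Ici.2 le_rfl
  have h₁ := (hdiff.hasDerivAt.hasDerivWithinAt (s := Set.Ici (-r m))).congr hsqrt (hsqrt _ hmem)
  have h₂ := (h₁.fun_mul h₁).congr_of_mem
    (fun x hx => (Real.mul_self_sqrt (by linarith [Set.mem_Ici.1 hx] : 0 ≤ x + r m)).symm) hmem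
  have h₃ := ((hasDerivAt_id (-r m)).add_const (r m)).hasDerivWithinAt (s := Set.Ici (-r m))
  have := (uniqueDiffWithinAt_Ici (-r m)).eq_deriv _ h₂ h₃
  simp at this

theorem convexOn_sinh : ConvexOn ℝ (Set.Ici 0) Real.sinh := by
  refine MonotoneOn.convexOn_of_deriv (convex_Ici 0) Real.continuous_sinh.continuousOn
    Real.differentiable_sinh.differentiableOn ?_
  rw [interior_Ici, Real.deriv_sinh]
  exact Real.cosh_strictMonoOn.monotoneOn.mono Ioi_subset_Ici_self

theorem mul_tanh_le_mul_tanh {x y : ℝ} (hx : 0 < x) (hxy : x < y) :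
    x * Real.tanh y ≤ y * Real.tanh x := by
  have h := convexOn_sinh.secant_mono (a := 0) (x := y - x) (y := y + x) (by simp)
    (Set.mem_Ici.2 (by linarith)) (Set.mem_Ici.2 (by linarith)) (by linarith) (by linarith)
    (by linarith)
  simp only [Real.sinh_zero, sub_zero] at h
  rw [div_le_div_iff₀ (by linarith) (by linarith), Real.sinh_sub, Real.sinh_add] at h
  rw [Real.tanh_eq_sinh_div_cosh, Real.tanh_eq_sinh_div_cosh, ← mul_div_assoc, ← mul_div_assoc,
    div_le_div_iff₀ (Real.cosh_pos _) (Real.cosh_pos _)]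
  linarith

theorem Gfun_abs (dpt : ℝ) (j : ℤ) : Gfun dpt |j| = Gfun dpt j := by
  rcases abs_choice j with h | h <;> simp [h, Gfun]

theorem Gfun_pos {dpt : ℝ} (hdpt : 0 < dpt) {j : ℤ} (hj : j ≠ 0) : 0 < Gfun dpt j := by
  rw [← Gfun_abs]
  have : (0 : ℝ) < (|j| : ℤ) := by exact_mod_cast abs_pos.2 hj
  rw [Gfun, Real.tanh_eq_sinh_div_cosh]
  exact mul_pos this (div_pos (Real.sinh_pos_iff.2 (mul_pos hdpt this)) (Real.cosh_pos _))

/-- The shift `r` such that `ω_j(κ)` is a multiple of `√(κ + r)`. -/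
noncomputable def sqrtShift (dpt g γ : ℝ) (j : ℤ) : ℝ :=
  g / (j : ℝ) ^ 2 + γ ^ 2 / 4 * (Gfun dpt j / (j : ℝ) ^ 4)

theorem sqrtShift_abs (dpt g γ : ℝ) (j : ℤ) : sqrtShift dpt g γ |j| = sqrtShift dpt g γ j := by
  simp [sqrtShift, Gfun_abs, Even.pow_abs (show Even 4 by decide)]

theorem sqrtShift_pos {dpt g : ℝ} (γ : ℝ) (hdpt : 0 < dpt) (hg : 0 < g) {j : ℤ} (hj : j ≠ 0) :
    0 < sqrtShift dpt g γ j := by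
  have := Gfun_pos hdpt hj
  have : (j : ℝ) ≠ 0 := by exact_mod_cast hj
  unfold sqrtShift
  positivity

theorem sqrtShift_lt_of_lt {dpt g : ℝ} (γ : ℝ) (hdpt : 0 < dpt) (hg : 0 < g) {j k : ℤ} (hj : 0 < j)
    (hjk : j < k) : sqrtShift dpt g γ k < sqrtShift dpt g γ j := by
  have hj' : (0 : ℝ) < j := by exact_mod_cast hj
  have hjk' : (j : ℝ) < k := by exact_mod_cast hjk
  have hk' := hj'.trans hjk'
  have ht := mul_tanh_le_mul_tanh (mul_pos hdpt hj') (mul_lt_mul_of_pos_left hjk' hdpt)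
  have ht : j * Real.tanh (dpt * k) ≤ k * Real.tanh (dpt * j) :=
    le_of_mul_le_mul_left (by linarith) hdpt
  have hG : Gfun dpt k / (k : ℝ) ^ 4 ≤ Gfun dpt j / (j : ℝ) ^ 4 := by
    have hle : Gfun dpt k / (k : ℝ) ^ 2 ≤ Gfun dpt j / (j : ℝ) ^ 2 := by
      rw [div_le_div_iff₀ (by positivity) (by positivity), Gfun, Gfun]
      nlinarith [mul_le_mul_of_nonneg_left ht (mul_pos hj' hk').le]
    calc Gfun dpt k / (k : ℝ) ^ 4 = Gfun dpt k / (k : ℝ) ^ 2 / (k : ℝ) ^ 2 := by field_simp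
      _ ≤ Gfun dpt j / (j : ℝ) ^ 2 / (j : ℝ) ^ 2 := by
        have := Gfun_pos hdpt hj.ne'
        gcongr
      _ = Gfun dpt j / (j : ℝ) ^ 4 := by field_simp
  unfold sqrtShift
  refine add_lt_add_of_lt_of_le ?_ (mul_le_mul_of_nonneg_left hG (by positivity))
  gcongr

theorem abs_eq_abs_of_sqrtShift_eq {dpt g : ℝ} (γ : ℝ) (hdpt : 0 < dpt) (hg : 0 < g) {j k : ℤ}
    (hj : j ≠ 0) (hk : k ≠ 0) (h : sqrtShift dpt g γ j = sqrtShift dpt g γ k) : |j| = |k| := by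
  rw [← sqrtShift_abs, ← sqrtShift_abs dpt g γ k] at h
  rcases lt_trichotomy |j| |k| with hlt | heq | hlt
  · exact absurd h (sqrtShift_lt_of_lt γ hdpt hg (abs_pos.2 hj) hlt).ne'
  · exact heq
  · exact absurd h (sqrtShift_lt_of_lt γ hdpt hg (abs_pos.2 hk) hlt).ne

theorem omegaF_eq_mul_sqrt {dpt : ℝ} (g γ : ℝ) (hdpt : 0 < dpt) {j : ℤ} (hj : j ≠ 0) (κ : ℝ) :
    omegaF dpt g γ j κ = √(Gfun dpt j * (j : ℝ) ^ 2) * √(κ + sqrtShift dpt g γ j) := by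
  have := Gfun_pos hdpt hj
  have : (j : ℝ) ≠ 0 := by exact_mod_cast hj
  rw [← Real.sqrt_mul (by positivity), omegaF, sqrtShift]
  congr 1
  field_simp
  ring

/-- Non-degeneracy I, item 1: the tangential frequency curve `Ω⃗` is non-degenerate. -/
theorem nondegeneracy_I_item1
    (dpt g γ κ₁ κ₂ : ℝ) (hdpt : 0 < dpt) (hg : 0 < g) (hκ₁ : 0 < κ₁) (hκ₁₂ : κ₁ < κ₂)
    (ν : ℕ) (hν : 1 ≤ ν) (jbar : Fin ν → ℤ)
    (hjne : ∀ a, jbar a ≠ 0)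
    (hjinj : Function.Injective fun a => |jbar a|) :
    ∀ c : Fin ν → ℝ, c ≠ 0 →
      ∃ κ ∈ Set.Icc κ₁ κ₂, (∑ a, c a * OmegaF dpt g γ (jbar a) κ) ≠ 0 := by
  intro c hc
  by_contra! h
  refine hc (funext fun a => ?_)
  have hsum : ∀ κ ∈ Set.Icc κ₁ κ₂,
      ∑ a, c a * √(Gfun dpt (jbar a) * (jbar a : ℝ) ^ 2) * √(κ + sqrtShift dpt g γ (jbar a)) +
        ∑ a, c a * (γ / 2 * Gfun dpt (jbar a) / (jbar a : ℝ)) = 0 := by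
    intro κ hκ
    rw [← h κ hκ, ← Finset.sum_add_distrib]
    refine Finset.sum_congr rfl fun a _ => ?_
    rw [OmegaF, omegaF_eq_mul_sqrt g γ hdpt (hjne a)]
    ring
  have hzero := eq_zero_of_sum_mul_sqrt_add_eq_zero
    (r := fun a => sqrtShift dpt g γ (jbar a))
    (fun a b hab => hjinj (abs_eq_abs_of_sqrtShift_eq γ hdpt hg (hjne a) (hjne b) hab))
    (fun a => add_pos hκ₁ (sqrtShift_pos γ hdpt hg (hjne a))) hκ₁₂ hsum a
  have := Gfun_pos hdpt (hjne a)
  have hj : (jbar a : ℝ) ≠ 0 := by exact_mod_cast hjne a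
  exact (mul_eq_zero.1 hzero).resolve_right (by positivity)
end

section
/- (Non-degeneracy I, item 3.) For every j ∈ ℤ \ ({0} ∪ S ∪ (−S)), the map κ ↦ (Ω⃗(κ), Ω_j(κ)) from [κ₁, κ₂] to ℝ^{ν+1} is non-degenerate: for every (c, d) ∈ ℝ^ν × ℝ with (c, d) ≠ 0 there exists κ ∈ [κ₁, κ₂] such that Σ_{a=1}^{ν} c_a · Ω_{j̄_a}(κ) + d·Ω_j(κ) ≠ 0. -/
open Real Finset Set

/-- On the positive half-line, `tanh x / x` is nonincreasing. -/
theorem tanh_div_le_tanh_div {x y : ℝ} (hx : 0 < x) (hxy : x < y) :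
    Real.tanh y / y ≤ Real.tanh x / x := by
  have hconv : StrictConvexOn ℝ (Set.Ici 0) Real.sinh := by
    refine strictConvexOn_of_deriv2_pos (convex_Ici 0) Real.continuous_sinh.continuousOn ?_
    intro z hz
    rw [interior_Ici] at hz
    simpa using hz
  have h := hconv.secant_strict_mono (a := 0) (x := y - x) (y := x + y) (by simp)
    (by simp; linarith) (by simp; linarith) (by linarith) (by linarith) (by linarith)
  simp only [Real.sinh_zero, sub_zero] at h
  rw [div_lt_div_iff₀ (by linarith) (by linarith), Real.sinh_add, Real.sinh_sub] at h
  have hcx := Real.cosh_pos x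
  have hcy := Real.cosh_pos y
  have hy := hx.trans hxy
  rw [Real.tanh_eq_sinh_div_cosh, Real.tanh_eq_sinh_div_cosh, div_div, div_div,
    div_le_div_iff₀ (by positivity) (by positivity)]
  nlinarith

/-- The number `r_j` such that the radicand of `ω_j(κ)` is proportional to `κ + r_j`. -/
noncomputable def radicandShift (dpt g γ x : ℝ) : ℝ :=
  g / x ^ 2 + γ ^ 2 / 4 * (Real.tanh (dpt * x) / x ^ 3)

theorem tanh_nonneg_of_nonneg {x : ℝ} (hx : 0 ≤ x) : 0 ≤ Real.tanh x := by
  rw [Real.tanh_eq_sinh_div_cosh]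
  exact div_nonneg (Real.sinh_nonneg_iff.2 hx) (Real.cosh_pos x).le

theorem radicandShift_abs (dpt g γ x : ℝ) :
    radicandShift dpt g γ |x| = radicandShift dpt g γ x := by
  rcases abs_choice x with h | h <;> rw [h]
  simp [radicandShift, Real.tanh_neg, Odd.neg_pow (show Odd 3 by decide), neg_div_neg_eq]

theorem radicandShift_pos {dpt g : ℝ} (hdpt : 0 < dpt) (hg : 0 < g) (γ : ℝ) {x : ℝ}
    (hx : x ≠ 0) : 0 < radicandShift dpt g γ x := by
  rw [← radicandShift_abs, radicandShift]
  have h := abs_pos.2 hx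
  have := tanh_nonneg_of_nonneg (mul_nonneg hdpt.le h.le)
  positivity

theorem radicandShift_strictAntiOn {dpt g : ℝ} (hdpt : 0 < dpt) (hg : 0 < g) (γ : ℝ) :
    StrictAntiOn (radicandShift dpt g γ) (Set.Ioi 0) := by
  intro x (hx : 0 < x) y (hy : 0 < y) hxy
  have hsq : x ^ 2 < y ^ 2 := by gcongr
  have htanh : Real.tanh (dpt * y) / y ^ 3 ≤ Real.tanh (dpt * x) / x ^ 3 := by
    have h := tanh_div_le_tanh_div (mul_pos hdpt hx) (mul_lt_mul_of_pos_left hxy hdpt)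
    have hnonneg := tanh_nonneg_of_nonneg (mul_pos hdpt hx).le
    calc Real.tanh (dpt * y) / y ^ 3
        = dpt * (Real.tanh (dpt * y) / (dpt * y)) / y ^ 2 := by field_simp
      _ ≤ dpt * (Real.tanh (dpt * x) / (dpt * x)) / x ^ 2 := by gcongr
      _ = Real.tanh (dpt * x) / x ^ 3 := by field_simp
  have hgrav : g / y ^ 2 < g / x ^ 2 := by gcongr
  have := mul_le_mul_of_nonneg_left htanh (by positivity : 0 ≤ γ ^ 2 / 4)
  unfold radicandShift
  linarith

theorem omegaF_eq {dpt : ℝ} (hdpt : 0 < dpt) (g γ : ℝ) {j : ℤ} (hj : j ≠ 0) (κ : ℝ) :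
    omegaF dpt g γ j κ =
      Real.sqrt (Gfun dpt j * (j : ℝ) ^ 2) * (κ + radicandShift dpt g γ j) ^ (1 / 2 : ℝ) := by
  have hj' : (j : ℝ) ≠ 0 := Int.cast_ne_zero.2 hj
  have hG := Gfun_pos hdpt hj
  rw [← Real.sqrt_eq_rpow, ← Real.sqrt_mul (by positivity), omegaF]
  congr 1
  unfold radicandShift Gfun
  field_simp
  ring

theorem abs_cast_injective_cons {ν : ℕ} {jbar : Fin ν → ℤ}
    (hjinj : Function.Injective fun a => |jbar a|) {j : ℤ} (h₁ : ∀ a, j ≠ jbar a)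
    (h₂ : ∀ a, j ≠ -jbar a) :
    Function.Injective fun i => |(Fin.cons j jbar : Fin (ν + 1) → ℤ) i| := by
  have hne : ∀ a, |j| ≠ |jbar a| := fun a h => (abs_eq_abs.1 h).elim (h₁ a) (h₂ a)
  intro i k hik
  induction i using Fin.cases <;> induction k using Fin.cases
  · rfl
  · exact absurd hik (hne _)
  · exact absurd hik.symm (hne _)
  · exact congrArg Fin.succ (hjinj hik)

/-- Successive derivatives of a constant combination of shifted square roots vanish. -/
theorem sum_mul_rpow_eq_zero {n : ℕ} {r b : Fin n → ℝ} {s t C : ℝ}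
    (hpos : ∀ i, ∀ κ ∈ Set.Ioo s t, 0 < κ + r i)
    (hconst : ∀ κ ∈ Set.Ioo s t, ∑ i, b i * (κ + r i) ^ (1 / 2 : ℝ) = C) (m : ℕ) :
    ∀ κ ∈ Set.Ioo s t, ∑ i, b i * (κ + r i) ^ (1 / 2 - ((m : ℝ) + 1)) = 0 := by
  have step : ∀ (p C : ℝ), p ≠ 0 →
      (∀ κ ∈ Set.Ioo s t, ∑ i, b i * (κ + r i) ^ p = C) →
      ∀ κ ∈ Set.Ioo s t, ∑ i, b i * (κ + r i) ^ (p - 1) = 0 := by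
    intro p C hp h κ hκ
    have hd : HasDerivAt (fun κ => ∑ i, b i * (κ + r i) ^ p)
        (∑ i, b i * (1 * p * (κ + r i) ^ (p - 1))) κ :=
      HasDerivAt.fun_sum fun i _ =>
        (((hasDerivAt_id κ).add_const (r i)).rpow_const (Or.inl (hpos i κ hκ).ne')).const_mul (b i)
    have hc : HasDerivAt (fun κ => ∑ i, b i * (κ + r i) ^ p) 0 κ :=
      (hasDerivAt_const κ C).congr_of_eventuallyEq
        (Filter.eventually_of_mem (Ioo_mem_nhds hκ.1 hκ.2) h)
    have heq := hd.unique hc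
    have : p * ∑ i, b i * (κ + r i) ^ (p - 1) = 0 := by
      rw [← heq, Finset.mul_sum]
      exact Finset.sum_congr rfl fun i _ => by ring
    exact (mul_eq_zero.1 this).resolve_left hp
  induction m with
  | zero => simpa using step (1 / 2) C (by norm_num) hconst
  | succ m ih =>
    have hp : 1 / 2 - ((m : ℝ) + 1) ≠ 0 := by
      have : (0 : ℝ) ≤ m := m.cast_nonneg
      intro h
      linarith
    intro κ hκ
    rw [← step _ 0 hp ih κ hκ]
    refine Finset.sum_congr rfl fun i _ => ?_
    congr 2
    push_cast
    ring

/-- Square roots with distinct shifts are linearly independent modulo constants. -/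
theorem eq_zero_of_sum_mul_rpow_half_const {n : ℕ} {r b : Fin n → ℝ} {s t C : ℝ} (hst : s < t)
    (hr : Function.Injective r) (hpos : ∀ i, ∀ κ ∈ Set.Ioo s t, 0 < κ + r i)
    (hconst : ∀ κ ∈ Set.Ioo s t, ∑ i, b i * (κ + r i) ^ (1 / 2 : ℝ) = C) : b = 0 := by
  obtain ⟨κ, hκ⟩ := Set.nonempty_Ioo.2 hst
  have hinj : Function.Injective fun i => (κ + r i)⁻¹ := fun i k h =>
    hr (add_left_cancel (inv_injective h))
  have hv : (fun i => b i * (κ + r i) ^ (-(1 / 2) : ℝ)) = 0 := by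
    refine Matrix.eq_zero_of_forall_pow_sum_mul_pow_eq_zero hinj fun m => ?_
    rw [← sum_mul_rpow_eq_zero hpos hconst m κ hκ]
    refine Finset.sum_congr rfl fun i _ => ?_
    have hi := hpos i κ hκ
    rw [inv_pow, ← Real.rpow_natCast, ← Real.rpow_neg hi.le, mul_assoc, ← Real.rpow_add hi]
    congr 2
    ring
  funext i
  exact (mul_eq_zero.1 (congrFun hv i)).resolve_right (Real.rpow_pos_of_pos (hpos i κ hκ) _).ne'

/-- Non-degeneracy I, item 3: for any j not in {0} ∪ S ∪ (−S), the curve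
κ ↦ (Ω⃗(κ), Ω_j(κ)) is non-degenerate. -/
theorem nondegeneracy_I_item3
    (dpt g γ κ₁ κ₂ : ℝ) (hdpt : 0 < dpt) (hg : 0 < g) (hκ₁ : 0 < κ₁) (hκ₁₂ : κ₁ < κ₂)
    (ν : ℕ) (hν : 1 ≤ ν) (jbar : Fin ν → ℤ)
    (hjne : ∀ a, jbar a ≠ 0)
    (hjinj : Function.Injective fun a => |jbar a|) :
    ∀ j : ℤ, j ≠ 0 → (∀ a, j ≠ jbar a) → (∀ a, j ≠ -jbar a) →
      ∀ (c : Fin ν → ℝ) (d : ℝ), (c ≠ 0 ∨ d ≠ 0) →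
        ∃ κ ∈ Set.Icc κ₁ κ₂,
          (∑ a, c a * OmegaF dpt g γ (jbar a) κ) + d * OmegaF dpt g γ j κ ≠ 0 := by
  intro j hj hj₁ hj₂ c d hcd
  by_contra! hzero
  let J : Fin (ν + 1) → ℤ := Fin.cons j jbar
  let e : Fin (ν + 1) → ℝ := Fin.cons d c
  have hJ : ∀ i, J i ≠ 0 := fun i => by
    induction i using Fin.cases with
    | zero => exact hj
    | succ a => exact hjne a
  have hJ' : ∀ i, (J i : ℝ) ≠ 0 := fun i => Int.cast_ne_zero.2 (hJ i)
  have hr : Function.Injective fun i => radicandShift dpt g γ (J i) := by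
    intro i k hik
    dsimp only at hik
    rw [← radicandShift_abs dpt g γ (J i), ← radicandShift_abs dpt g γ (J k)] at hik
    have habs := (radicandShift_strictAntiOn hdpt hg γ).injOn
      (abs_pos.2 (hJ' i)) (abs_pos.2 (hJ' k)) hik
    exact abs_cast_injective_cons hjinj hj₁ hj₂ (by exact_mod_cast habs)
  have hb := eq_zero_of_sum_mul_rpow_half_const
    (b := fun i => e i * Real.sqrt (Gfun dpt (J i) * (J i : ℝ) ^ 2))
    (C := -∑ i, e i * (γ / 2 * Gfun dpt (J i) / J i)) hκ₁₂ hr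
    (fun i κ hκ => add_pos (hκ₁.trans hκ.1) (radicandShift_pos hdpt hg γ (hJ' i)))
    (fun κ hκ => by
      have hsum : ∑ i, e i * OmegaF dpt g γ (J i) κ = 0 := by
        rw [Fin.sum_univ_succ, add_comm]
        exact hzero κ ⟨hκ.1.le, hκ.2.le⟩
      rw [eq_neg_iff_add_eq_zero, ← hsum, ← Finset.sum_add_distrib]
      refine Finset.sum_congr rfl fun i _ => ?_
      rw [OmegaF, omegaF_eq hdpt g γ (hJ i)]
      ring)
  have he : ∀ i, e i = 0 := fun i => by
    refine (mul_eq_zero.1 (congrFun hb i)).resolve_right (Real.sqrt_ne_zero'.2 ?_)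
    have := Gfun_pos hdpt (hJ i)
    have := hJ' i
    positivity
  exact hcd.elim (fun h => h (funext fun a => he a.succ)) fun h => h (he 0)
end
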